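/- Let S, S', T, T' be nice triples that are pairwise concordant. Then S⊗T and S'⊗T' are concordant; if moreover S and S' are congruent and T and T' are congruent, then S⊗T and S'⊗T' are congruent. In addition, S⊗T and T⊗S are congruent. -/

import Mathlib

/-- The three-letter alphabet `S = {0, 1, ∗}`. -/
inductive Tern | zero | one | star
deriving DecidableEq, Repr

/-- A string over `S`. -/
abbrev Str := List Tern

/-- A (ordered) list of strings over `S`. -/
abbrev SList := List Str

/-- `clash x y` is true iff both `x, y ∈ {0,1}` and `x ≠ y`. -/
def clash : Tern → Tern → Bool
  | Tern.zero, Tern.one => true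
  | Tern.one, Tern.zero => true
  | _, _ => false

/-- `dist u v`: the number of positions where both letters are binary and differ. -/
def distS (u v : Str) : ℕ := (u.zip v).countP (fun p => clash p.1 p.2)

/-- all strings of a list have length `m` -/
def uniform (L : SList) (m : ℕ) : Prop := ∀ s ∈ L, s.length = m

/-- A list is `k`-neighborly if any two entries occupying distinct positions `u, v`
satisfy `1 ≤ dist(u,v) ≤ k`. -/
def kNbr (k : ℕ) (L : SList) : Prop :=
  L.Pairwise (fun u v => 1 ≤ distS u v ∧ distS u v ≤ k)

/-- The pairing `A ⊖ B`: entrywise concatenation of strings. -/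
def pairL (A B : SList) : SList := List.zipWith (· ++ ·) A B

/-- The concatenation `AB = [v_i w_j]`, ordered lexicographically in `(i,j)`. -/
def concL (A B : SList) : SList := A.flatMap (fun u => B.map (fun v => u ++ v))

/-- the string `∗^m` of `m` jokers -/
def stars (m : ℕ) : Str := List.replicate m Tern.star

/-- A triple of lists `T = (A,B,C)` together with the (intended common) string
lengths `a` of the entries of `A` and `b` of the entries of `B` (and `C`). -/
structure Triple where
  a : ℕ
  b : ℕ
  A : SList
  B : SList
  C : SList

namespace Triple

/-- `α(T)`: the common length of the strings of `A`. -/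
def alpha (T : Triple) : ℕ := T.a

/-- `β(T)`: the common length of the strings of `B`. -/
def beta (T : Triple) : ℕ := T.b

/-- `δ(T) = α(T) + β(T)`. -/
def delta (T : Triple) : ℕ := T.a + T.b

/-- `n(T) = |A|`. -/
def nT (T : Triple) : ℕ := T.A.length

/-- `g(T) = |C|`. -/
def gT (T : Triple) : ℕ := T.C.length

/-- A triple `T = (A,B,C)` is nice if: (1) `dist(u,v) ≤ 1` for all entries `u,v` of `A`;
(2) `|A| = |B|` and `A ⊖ B` is 2-neighborly; (3) `C` is a 1-neighborly sublist of `B`,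
and `dist(u,v) ≤ 1` for every entry `u` of `B` and every entry `v` of `C`.
(The strings of `A` all have length `α(T)` and those of `B` length `β(T)`.) -/
def Nice (T : Triple) : Prop :=
  uniform T.A T.a ∧ uniform T.B T.b ∧
  (∀ u ∈ T.A, ∀ v ∈ T.A, distS u v ≤ 1) ∧
  T.A.length = T.B.length ∧
  kNbr 2 (pairL T.A T.B) ∧
  T.C.Sublist T.B ∧ kNbr 1 T.C ∧
  (∀ u ∈ T.B, ∀ v ∈ T.C, distS u v ≤ 1)

/-- `T, T'` are concordant if `α(T) = α(T')` and `dist(u,v) ≤ 1` for all entries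
`u, v` of `A + A'`. -/
def Concordant (T T' : Triple) : Prop :=
  T.a = T'.a ∧ ∀ u ∈ T.A ++ T'.A, ∀ v ∈ T.A ++ T'.A, distS u v ≤ 1

/-- The compound `T ⊗ T' = (A'', B'', C'')` where
`A'' = [0]A + [0]A' + (|C|·|C'|)·([1][∗^{α(T)}])`,
`B'' = [0]B[∗^{β(T')}] + [1][∗^{β(T)}]B' + [∗]CC'`,
`C'' = [0]C[∗^{β(T')}] + [1][∗^{β(T)}]C'`. -/
def compound (T T' : Triple) : Triple where
  a := T.a + 1
  b := T.b + T'.b + 1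
  A := (T.A.map (fun u => Tern.zero :: u)) ++ (T'.A.map (fun u => Tern.zero :: u)) ++
       List.replicate (T.C.length * T'.C.length) (Tern.one :: stars T.a)
  B := (T.B.map (fun u => Tern.zero :: (u ++ stars T'.b))) ++
       (T'.B.map (fun u => Tern.one :: (stars T.b ++ u))) ++
       ((concL T.C T'.C).map (fun u => Tern.star :: u))
  C := (T.C.map (fun u => Tern.zero :: (u ++ stars T'.b))) ++
       (T'.C.map (fun u => Tern.one :: (stars T.b ++ u)))

/-- `T, T'` are congruent if they are concordant, `β(T) = β(T')`, `n(T) = n(T')`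
and `g(T) = g(T')`. -/
def Congruent (T T' : Triple) : Prop :=
  Concordant T T' ∧ T.b = T'.b ∧ T.A.length = T'.A.length ∧ T.C.length = T'.C.length

end Triple

theorem distS_cons (x y : Tern) (u v : Str) :
    distS (x :: u) (y :: v) = distS u v + if clash x y then 1 else 0 := by
  simp [distS, List.countP_cons]

theorem clash_comm (x y : Tern) : clash x y = clash y x := by
  cases x <;> cases y <;> rfl

theorem distS_comm (u v : Str) : distS u v = distS v u := by
  induction u generalizing v with
  | nil => cases v <;> rfl
  | cons x u ih =>
    cases v with
    | nil => rfl
    | cons y v => rw [distS_cons, distS_cons, ih, clash_comm]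

theorem distS_stars_left (m : ℕ) (v : Str) : distS (stars m) v = 0 := by
  induction m generalizing v with
  | zero => rfl
  | succ m ih =>
    cases v with
    | nil => rfl
    | cons y v =>
      change distS (Tern.star :: stars m) (y :: v) = 0
      rw [distS_cons, ih]
      cases y <;> rfl

theorem distS_stars_right (m : ℕ) (v : Str) : distS v (stars m) = 0 := by
  rw [distS_comm, distS_stars_left]

namespace Triple

theorem mem_compound_A {P Q : Triple} {u : Str} (hu : u ∈ (compound P Q).A) :
    (∃ w ∈ P.A ++ Q.A, u = Tern.zero :: w) ∨ u = Tern.one :: stars P.a := by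
  simp only [compound, List.mem_append, List.mem_map, List.mem_replicate] at hu
  rcases hu with (⟨w, hw, rfl⟩ | ⟨w, hw, rfl⟩) | ⟨-, rfl⟩
  · exact Or.inl ⟨w, List.mem_append_left _ hw, rfl⟩
  · exact Or.inl ⟨w, List.mem_append_right _ hw, rfl⟩
  · exact Or.inr rfl

theorem length_compound_A (P Q : Triple) :
    (compound P Q).A.length = P.A.length + Q.A.length + P.C.length * Q.C.length := by
  simp [compound, add_assoc]

theorem length_compound_C (P Q : Triple) :
    (compound P Q).C.length = P.C.length + Q.C.length := by
  simp [compound]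

theorem concordant_compound {P Q P' Q' : Triple} (ha : P.a = P'.a)
    (h : ∀ u ∈ (P.A ++ Q.A) ++ (P'.A ++ Q'.A), ∀ v ∈ (P.A ++ Q.A) ++ (P'.A ++ Q'.A),
      distS u v ≤ 1) :
    Concordant (compound P Q) (compound P' Q') := by
  have key : ∀ u ∈ (compound P Q).A ++ (compound P' Q').A,
      (∃ w ∈ (P.A ++ Q.A) ++ (P'.A ++ Q'.A), u = Tern.zero :: w) ∨
        u = Tern.one :: stars P.a := by
    intro u hu
    rcases List.mem_append.1 hu with hu | hu
    · rcases mem_compound_A hu with ⟨w, hw, rfl⟩ | rfl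
      · exact Or.inl ⟨w, List.mem_append_left _ hw, rfl⟩
      · exact Or.inr rfl
    · rcases mem_compound_A hu with ⟨w, hw, rfl⟩ | rfl
      · exact Or.inl ⟨w, List.mem_append_right _ hw, rfl⟩
      · exact Or.inr (by rw [ha])
  refine ⟨congrArg (· + 1) ha, fun u hu v hv => ?_⟩
  rcases key u hu with ⟨w, hw, rfl⟩ | rfl <;> rcases key v hv with ⟨x, hx, rfl⟩ | rfl
  · simpa [distS_cons, clash] using h w hw x hx
  · simp [distS_cons, distS_stars_right, clash]
  · simp [distS_cons, distS_stars_left, clash]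
  · simp [distS_cons, distS_stars_left, clash]

end Triple

open Triple in
/-- If `S, S', T, T'` are nice, pairwise concordant triples, then `S⊗T` and `S'⊗T'`
are concordant; if moreover `S, S'` are congruent and `T, T'` are congruent, then
`S⊗T` and `S'⊗T'` are congruent. In addition, `S⊗T` and `T⊗S` are congruent. -/
theorem compound_concordant_congruent (S S' T T' : Triple)
    (hS : Nice S) (hS' : Nice S') (hT : Nice T) (hT' : Nice T')
    (h1 : Concordant S S') (h2 : Concordant S T) (h3 : Concordant S T')
    (h4 : Concordant S' T) (h5 : Concordant S' T') (h6 : Concordant T T') :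
    Concordant (compound S T) (compound S' T') ∧
    (Congruent S S' → Congruent T T' → Congruent (compound S T) (compound S' T')) ∧
    Congruent (compound S T) (compound T S) := by
  have hdist : ∀ u ∈ (S.A ++ T.A) ++ (S'.A ++ T'.A), ∀ v ∈ (S.A ++ T.A) ++ (S'.A ++ T'.A),
      distS u v ≤ 1 := by
    have e1 := h1.2
    have e2 := h2.2
    have e3 := h3.2
    have e4 := h4.2
    have e5 := h5.2
    have e6 := h6.2
    simp only [List.mem_append] at *
    rintro u ((hu | hu) | (hu | hu)) v ((hv | hv) | (hv | hv)) <;> grind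
  have hconc : Concordant (compound S T) (compound S' T') := concordant_compound h1.1 hdist
  refine ⟨hconc, ?_, ?_, ?_, ?_, ?_⟩
  · rintro ⟨-, hb, hA, hC⟩ ⟨-, hb', hA', hC'⟩
    refine ⟨hconc, ?_, ?_, ?_⟩
    · simp only [compound, hb, hb']
    · simp only [length_compound_A, hA, hA', hC, hC']
    · simp only [length_compound_C, hC, hC']
  · refine concordant_compound h2.1 fun u hu v hv => h2.2 u ?_ v ?_
    · simp only [List.mem_append] at hu ⊢
      tauto
    · simp only [List.mem_append] at hv ⊢
      tauto
  · simp only [compound]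
    omega
  · rw [length_compound_A, length_compound_A]
    ring
  · rw [length_compound_C, length_compound_C, add_comm]
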